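/- Let A_k^H = (1/√2)·[[e^{−ik}, e^{−ik}],[e^{ik}, −e^{ik}]] be the Hadamard quantum walk in the wave-vector representation. Then there is no 2×2 unitary matrix P with P² = I, P ≠ I and P ≠ −I such that P · A_k^H · P = A_{−k}^H for all k ∈ ℝ. Consequently, the Hadamard walk is not parity invariant and cannot be obtained as a coarse-graining of a scalar quantum walk on the infinite dihedral group. -/

import Mathlib

open Matrix

/-- The Hadamard quantum walk in the wave-vector representation. -/
noncomputable def hadamardQW (k : ℝ) : Matrix (Fin 2) (Fin 2) ℂ :=
  ((1 / Real.sqrt 2 : ℝ) : ℂ) •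
    !![Complex.exp (-(Complex.I * (k : ℂ))), Complex.exp (-(Complex.I * (k : ℂ)));
       Complex.exp (Complex.I * (k : ℂ)), -Complex.exp (Complex.I * (k : ℂ))]

lemma trace_hadamardQW (k : ℝ) :
    (hadamardQW k).trace = -(Real.sqrt 2 * Real.sin k : ℝ) * Complex.I := by
  have h2 : (2 : ℂ) = (Real.sqrt 2 : ℂ) * (Real.sqrt 2 : ℂ) := by
    rw [← Complex.ofReal_mul, Real.mul_self_sqrt (by norm_num), Complex.ofReal_ofNat]
  have h0 : (Real.sqrt 2 : ℂ) ≠ 0 := by simp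
  have e₁ : Complex.exp (Complex.I * k) = Complex.cos k + Complex.sin k * Complex.I := by
    rw [mul_comm, Complex.exp_mul_I]
  have e₂ : Complex.exp (-(Complex.I * k)) = Complex.cos k - Complex.sin k * Complex.I := by
    rw [show -(Complex.I * k) = (-k : ℂ) * Complex.I by ring, Complex.exp_mul_I,
      Complex.cos_neg, Complex.sin_neg]
    ring
  simp only [hadamardQW, Matrix.trace_smul, Matrix.trace_fin_two_of, e₁, e₂, smul_eq_mul]
  push_cast
  field_simp
  linear_combination (-Complex.I * Complex.sin k) * h2

/-- The Hadamard walk is not parity invariant: there is no unitary `P` with `P² = I`,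
`P ≠ ±I` and `P A_k^H P = A_{−k}^H` for all `k`. Consequently it cannot be obtained as a
coarse-graining of a scalar quantum walk on the infinite dihedral group. -/
theorem hadamard_not_parity_invariant :
    ¬ ∃ P : Matrix (Fin 2) (Fin 2) ℂ,
      P ∈ Matrix.unitaryGroup (Fin 2) ℂ ∧ P * P = 1 ∧ P ≠ 1 ∧ P ≠ -1 ∧
      ∀ k : ℝ, P * hadamardQW k * P = hadamardQW (-k) := by
  rintro ⟨P, -, hP, -, -, h⟩
  have ht := congrArg Matrix.trace (h (Real.pi / 2))
  rw [Matrix.trace_mul_comm, ← mul_assoc, hP, one_mul, trace_hadamardQW, trace_hadamardQW,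
    Real.sin_neg, Real.sin_pi_div_two] at ht
  have hs : (Real.sqrt 2 : ℂ) * Complex.I = 0 := by
    push_cast at ht
    linear_combination -ht / 2
  simp at hs
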